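/- arXiv:2505.22049 — 2 statements merged into one kernel-verified Lean document; each statement's English description precedes it below -/
import Mathlib

section
/- Let p ≥ 1 and let u, v : Fin n → ℝ be nondecreasing families of real numbers (u_i ≤ u_{i'} and v_i ≤ v_{i'} whenever i ≤ i'). Then for every permutation ρ of Fin n, Σ_{i} |u_i − v_i|^p ≤ Σ_{i} |u_i − v_{ρ(i)}|^p. That is, the monotone (identity) assignment between sorted sequences minimizes the total cost Σ_i |u_i − v_{ρ(i)}|^p over all permutations ρ. -/
open Finset

/-- A convex function has a smaller sum at an inner pair of points than at an outer pair
with the same midpoint. -/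
theorem ConvexOn.add_le_add_of_add_eq {f : ℝ → ℝ} (hf : ConvexOn ℝ Set.univ f)
    {x y z w : ℝ} (hxy : x ≤ y) (hxz : x ≤ z) (h : y + z = x + w) :
    f y + f z ≤ f x + f w := by
  rcases (show x ≤ w by linarith).eq_or_lt with rfl | hxw
  · obtain rfl : y = x := by linarith
    obtain rfl : z = y := by linarith
    exact le_rfl
  have hd : 0 < w - x := sub_pos.2 hxw
  have hs : 0 ≤ (y - x) / (w - x) := div_nonneg (sub_nonneg.2 hxy) hd.le
  have ht : 0 ≤ (z - x) / (w - x) := div_nonneg (sub_nonneg.2 hxz) hd.le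
  have hst : (z - x) / (w - x) + (y - x) / (w - x) = 1 := by
    rw [← add_div, div_eq_one_iff_eq hd.ne']
    linarith
  have hsw : (y - x) / (w - x) * (w - x) = y - x := div_mul_cancel₀ _ hd.ne'
  generalize (y - x) / (w - x) = s at *
  generalize (z - x) / (w - x) = t at *
  obtain rfl : t = 1 - s := by linarith
  have hy := hf.2 (Set.mem_univ x) (Set.mem_univ w) ht hs hst
  have hz := hf.2 (Set.mem_univ x) (Set.mem_univ w) hs ht (by linarith)
  simp only [smul_eq_mul] at hy hz
  rw [show (1 - s) * x + s * w = y by linarith] at hy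
  rw [show s * x + (1 - s) * w = z by linarith] at hz
  linarith

theorem convexOn_abs_rpow {p : ℝ} (hp : 1 ≤ p) :
    ConvexOn ℝ Set.univ fun x : ℝ => |x| ^ p := by
  refine ⟨convex_univ, fun x _ y _ a b ha hb hab => ?_⟩
  calc |a • x + b • y| ^ p ≤ (a • |x| + b • |y|) ^ p := by
        refine Real.rpow_le_rpow (abs_nonneg _) ?_ (by linarith)
        simpa [abs_mul, abs_of_nonneg ha, abs_of_nonneg hb] using abs_add_le (a * x) (b * y)
    _ ≤ a • |x| ^ p + b • |y| ^ p :=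
        (convexOn_rpow hp).2 (abs_nonneg x) (abs_nonneg y) ha hb hab

/-- For a cost satisfying the Monge condition, the identity is an optimal assignment. -/
theorem sum_diag_le_sum_perm_of_monge {α : Type*} [Fintype α] [LinearOrder α]
    (C : α → α → ℝ)
    (hC : ∀ i k j l, i ≤ k → j ≤ l → C i j + C k l ≤ C i l + C k j)
    (ρ : Equiv.Perm α) :
    ∑ i, C i i ≤ ∑ i, C i (ρ i) := by
  suffices H : ∀ (s : Finset α) (σ : Equiv.Perm α), (∀ x ∉ s, σ x = x) →
      ∑ i, C i i ≤ ∑ i, C i (σ i) from H univ ρ (by simp)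
  intro s
  induction s using Finset.induction_on_max with
  | empty =>
    intro σ hσ
    simp [hσ]
  | insert a s hmax ih =>
    intro σ hσ
    have hle : ∀ x, σ x ≠ x → x ≤ a := by
      intro x hx
      have hmem : x ∈ insert a s := by_contra fun h => hx (hσ x h)
      rcases Finset.mem_insert.1 hmem with rfl | h
      · exact le_rfl
      · exact (hmax x h).le
    obtain ⟨k, hk⟩ := σ.surjective a
    by_cases hka : k = a
    · subst hka
      refine ih σ fun x hx => ?_
      by_cases hxk : x = k
      · rw [hxk, hk]
      · exact hσ x (by simp [hxk, hx])
    have hk_le : k ≤ a := hle k (by rw [hk]; exact Ne.symm hka)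
    have hσa : σ a ≠ a := fun h => hka (σ.injective (hk.trans h.symm))
    have hσa_le : σ a ≤ a := hle _ fun h => hσa (σ.injective h)
    have hτ : ∀ x, x ≠ a → x ≠ k → Equiv.swap a (σ a) (σ x) = σ x := fun x hxa hxk =>
      Equiv.swap_apply_of_ne_of_ne (fun h => hxk (σ.injective (h.trans hk.symm)))
        (fun h => hxa (σ.injective h))
    refine (ih (σ.trans (Equiv.swap a (σ a))) fun x hx => ?_).trans ?_
    · by_cases hxa : x = a
      · simp [hxa]
      have hσx : σ x = x := hσ x (by simp [hxa, hx])
      have hxk : x ≠ k := by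
        rintro rfl
        exact hxa (hσx.symm.trans hk)
      simp only [Equiv.trans_apply]
      rw [hτ x hxa hxk, hσx]
    · have hsplit : ∀ g : α → ℝ, ∑ i, g i = g a + (g k + ∑ i ∈ (univ.erase a).erase k, g i) := by
        intro g
        rw [Finset.add_sum_erase _ _ (by simp [hka]), Finset.add_sum_erase _ _ (mem_univ a)]
      rw [hsplit, hsplit fun i => C i (σ i)]
      have hrest : ∑ i ∈ (univ.erase a).erase k, C i ((σ.trans (Equiv.swap a (σ a))) i) =
          ∑ i ∈ (univ.erase a).erase k, C i (σ i) := by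
        refine Finset.sum_congr rfl fun i hi => ?_
        simp only [Finset.mem_erase] at hi
        rw [Equiv.trans_apply, hτ i hi.2.1 hi.1]
      rw [hrest]
      simp only [Equiv.trans_apply, hk, Equiv.swap_apply_left, Equiv.swap_apply_right]
      linarith [hC k a (σ a) a hk_le hσa_le]

/-- One-dimensional optimal transport between sorted samples: if `u` and `v` are
nondecreasing families of reals and `p ≥ 1`, the monotone (identity) assignment
minimizes the total cost `Σ_i |u_i − v_{ρ(i)}|^p` over all permutations `ρ`. -/
theorem monotone_assignment_optimal
    {n : ℕ} (p : ℝ) (hp : 1 ≤ p)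
    (u v : Fin n → ℝ) (hu : Monotone u) (hv : Monotone v)
    (ρ : Equiv.Perm (Fin n)) :
    ∑ i, |u i - v i| ^ p ≤ ∑ i, |u i - v (ρ i)| ^ p := by
  refine sum_diag_le_sum_perm_of_monge (fun i j => |u i - v j| ^ p) (fun i k j l hik hjl => ?_) ρ
  have hu' := hu hik
  have hv' := hv hjl
  exact (convexOn_abs_rpow hp).add_le_add_of_add_eq (x := u i - v l) (w := u k - v j)
    (y := u i - v j) (z := u k - v l) (by linarith) (by linarith) (by ring)
end

section
/- Let a ∈ ℝ^n and b ∈ ℝ^m be probability weight vectors. Define the cumulative sums A_0 = 0, A_i = Σ_{l ≤ i} a_l and B_0 = 0, B_j = Σ_{l ≤ j} b_l. Define the matrix π by π_{ij} = max(0, min(A_i, B_j) − max(A_{i−1}, B_{j−1})). Then π ∈ U(a,b): all entries of π are nonnegative, Σ_j π_{ij} = a_i for every i, and Σ_i π_{ij} = b_j for every j. -/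
open Finset

/-- The transport polytope `U(a,b)`: nonnegative `n × m` matrices with row sums `a`
and column sums `b`. -/
def transportPolytope {n m : ℕ} (a : Fin n → ℝ) (b : Fin m → ℝ) :
    Set (Fin n → Fin m → ℝ) :=
  {π | (∀ i j, 0 ≤ π i j) ∧ (∀ i, ∑ j, π i j = a i) ∧ (∀ j, ∑ i, π i j = b j)}

/-- The cumulative sum of a weight vector: `cumsum a i = Σ_{l < i} a_l`
(so `cumsum a 0 = 0`). -/
def cumsum {n : ℕ} (a : Fin n → ℝ) (i : ℕ) : ℝ :=
  ∑ l ∈ Finset.univ.filter (fun l : Fin n => (l : ℕ) < i), a l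

theorem cumsum_zero {n : ℕ} (a : Fin n → ℝ) : cumsum a 0 = 0 := by
  simp [cumsum]

theorem cumsum_of_le {n : ℕ} (a : Fin n → ℝ) {k : ℕ} (hk : n ≤ k) : cumsum a k = ∑ i, a i := by
  unfold cumsum
  rw [Finset.filter_true_of_mem fun l _ => l.isLt.trans_le hk]

theorem cumsum_succ {n : ℕ} (a : Fin n → ℝ) (i : Fin n) :
    cumsum a ((i : ℕ) + 1) = cumsum a i + a i := by
  have h : Finset.univ.filter (fun l : Fin n => (l : ℕ) < (i : ℕ) + 1) =
      insert i (Finset.univ.filter fun l : Fin n => (l : ℕ) < i) := by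
    ext l
    simp only [Finset.mem_filter, Finset.mem_univ, true_and, Finset.mem_insert, Fin.ext_iff]
    omega
  unfold cumsum
  rw [h, Finset.sum_insert (by simp), add_comm]

theorem cumsum_mono {n : ℕ} {a : Fin n → ℝ} (ha : ∀ i, 0 ≤ a i) : Monotone (cumsum a) :=
  fun _ _ hjk => Finset.sum_le_sum_of_subset_of_nonneg
    (Finset.monotone_filter_right _ fun _ _ hl => lt_of_lt_of_le hl hjk) fun i _ _ => ha i

/-- The overlap length of `[s, t]` and `[u, v]` is the increment over `[u, v]` of the
clamping map onto `[s, t]`. -/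
theorem max_zero_min_sub_max {s t u v : ℝ} (hst : s ≤ t) (huv : u ≤ v) :
    max 0 (min t v - max s u) = max s (min t v) - max s (min t u) := by
  grind

/-- The overlaps of `[s, t] ⊆ [0, ∑ j, b j]` with the cells of the partition given by the
cumulative sums of `b` add up to the length of `[s, t]`. -/
theorem sum_overlap_cumsum {m : ℕ} {b : Fin m → ℝ} (hb : ∀ j, 0 ≤ b j) {s t : ℝ}
    (hs : 0 ≤ s) (hst : s ≤ t) (ht : t ≤ ∑ j, b j) :
    ∑ j : Fin m, max 0 (min t (cumsum b ((j : ℕ) + 1)) - max s (cumsum b (j : ℕ))) = t - s := by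
  simp_rw [fun j : ℕ => max_zero_min_sub_max hst (cumsum_mono hb j.le_succ)]
  rw [Fin.sum_univ_eq_sum_range
      (fun j => max s (min t (cumsum b (j + 1))) - max s (min t (cumsum b j))),
    Finset.sum_range_sub (fun j => max s (min t (cumsum b j))), cumsum_zero,
    cumsum_of_le b le_rfl, min_eq_left ht, min_eq_right (hs.trans hst), max_eq_right hst,
    max_eq_left hs]

theorem sum_overlap_cumsum_cumsum {n m : ℕ} {a : Fin n → ℝ} {b : Fin m → ℝ}
    (ha : ∀ i, 0 ≤ a i) (hb : ∀ j, 0 ≤ b j) (hab : ∑ i, a i = ∑ j, b j) (i : Fin n) :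
    ∑ j : Fin m, max 0 (min (cumsum a ((i : ℕ) + 1)) (cumsum b ((j : ℕ) + 1)) -
      max (cumsum a (i : ℕ)) (cumsum b (j : ℕ))) = a i := by
  have hs : 0 ≤ cumsum a i := cumsum_zero a ▸ cumsum_mono ha (Nat.zero_le i)
  have ht : cumsum a ((i : ℕ) + 1) ≤ ∑ j, b j := by
    rw [← hab, ← cumsum_of_le a le_rfl]
    exact cumsum_mono ha i.isLt
  rw [sum_overlap_cumsum hb hs (cumsum_mono ha (Nat.le_succ i)) ht, cumsum_succ,
    add_sub_cancel_left]

/-- The monotone (north-west corner / quantile) coupling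
`π_{ij} = max(0, min(A_i, B_j) − max(A_{i−1}, B_{j−1}))` defined from the cumulative
sums of two probability weight vectors belongs to the transport polytope `U(a,b)`. -/
theorem monotone_coupling_mem_transportPolytope
    {n m : ℕ} (a : Fin n → ℝ) (b : Fin m → ℝ)
    (ha : (∀ i, 0 ≤ a i) ∧ ∑ i, a i = 1) (hb : (∀ j, 0 ≤ b j) ∧ ∑ j, b j = 1) :
    (fun (i : Fin n) (j : Fin m) =>
        max 0 (min (cumsum a ((i : ℕ) + 1)) (cumsum b ((j : ℕ) + 1)) -
          max (cumsum a (i : ℕ)) (cumsum b (j : ℕ)))) ∈ transportPolytope a b := by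
  refine ⟨fun i j => le_max_left _ _,
    sum_overlap_cumsum_cumsum ha.1 hb.1 (ha.2.trans hb.2.symm), fun j => ?_⟩
  simp_rw [min_comm (cumsum a _), max_comm (cumsum a _)]
  exact sum_overlap_cumsum_cumsum hb.1 ha.1 (hb.2.trans ha.2.symm) j
end
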